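/- Let A and B be k-algebras of finite transcendence degree over k such that A is an AF-domain. Let P be a prime ideal of A⊗_kB, p = P∩A and q = P∩B. Then ht(P) = ht(q[t.d.(A)]) + ht(p) + ht(P/(p⊗_kB + A⊗_kq)), where q[t.d.(A)] denotes the extension of q to the polynomial ring B[X_1,...,X_{t.d.(A)}] and P/(p⊗_kB + A⊗_kq) denotes the image of P in (A⊗_kB)/(p⊗_kB + A⊗_kq). -/

import Mathlib

open TensorProduct

noncomputable section

/-- Transcendence degree of the `R`-algebra `A` as a cardinal: the supremum of the
cardinalities of algebraically independent subsets of `A` over `R`. -/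
def trdegC (R A : Type*) [CommRing R] [CommRing A] [Algebra R A] : Cardinal :=
  ⨆ s : { s : Set A // AlgebraicIndependent R ((↑) : s → A) }, Cardinal.mk s.1

/-- Transcendence degree of the `R`-algebra `A`, as an extended natural number. -/
def eTrdeg (R A : Type*) [CommRing R] [CommRing A] [Algebra R A] : ℕ∞ :=
  Cardinal.toENat (trdegC R A)

/-- Height of an ideal: the infimum of the heights of the prime ideals containing it,
the height of a prime being taken in the prime spectrum ordered by inclusion. -/
def idealHt {R : Type*} [CommRing R] (I : Ideal R) : ℕ∞ :=
  ⨅ P : { P : PrimeSpectrum R // I ≤ P.asIdeal }, Order.height P.1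

/-- The extension `p[n]` of an ideal `p` of `A` to the polynomial ring
`A[X_1, ..., X_n]`. -/
def polyExt {A : Type*} [CommRing A] (n : ℕ) (p : Ideal A) : Ideal (MvPolynomial (Fin n) A) :=
  p.map (MvPolynomial.C : A →+* MvPolynomial (Fin n) A)

/-- An AF-domain over `k`: a `k`-algebra which is an integral domain such that
`ht p + t.d.(A/p) = t.d.(A)` for every prime ideal `p` of `A`. -/
def IsAFDomain (k A : Type*) [Field k] [CommRing A] [IsDomain A] [Algebra k A] : Prop :=
  ∀ p : Ideal A, p.IsPrime → idealHt p + eTrdeg k (A ⧸ p) = eTrdeg k A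

theorem idealHt_eq_height {R : Type*} [CommRing R] (I : Ideal R) : idealHt I = I.height := by
  apply le_antisymm
  · rw [I.height_eq_inf_minimalPrimes]
    refine le_iInf₂ fun J hJ => ?_
    have := hJ.isPrime
    rw [PrimeSpectrum.height_eq_orderHeight ⟨J, this⟩]
    exact iInf_le_of_le ⟨⟨J, this⟩, hJ.1.2⟩ le_rfl
  · refine le_iInf fun P => ?_
    rw [← PrimeSpectrum.height_eq_orderHeight]
    exact Ideal.height_mono P.2

theorem ENat.add_le_of_forall_natCast_le {a b c : ℕ∞}
    (h : ∀ n : ℕ, (n : ℕ∞) ≤ a → c + n ≤ b) : c + a ≤ b := by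
  induction a using ENat.recTopCoe with
  | coe a => exact h a le_rfl
  | top =>
    rw [add_top, top_le_iff]
    exact ENat.eq_top_iff_forall_ge.mpr fun n => le_add_self.trans (h n le_top)

section Heights

variable {R S : Type*} [CommRing R] [CommRing S]

theorem Ideal.exists_lt_of_add_one_le_height {P : Ideal R} [hP : P.IsPrime] {n : ℕ}
    (h : ((n + 1 : ℕ) : ℕ∞) ≤ P.height) :
    ∃ Q : Ideal R, ∃ _ : Q.IsPrime, Q < P ∧ (n : ℕ∞) ≤ Q.height := by
  by_contra! H
  have : Order.height (⟨P, hP⟩ : PrimeSpectrum R) ≤ n := by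
    rw [Order.height_le_coe_iff]
    intro y hy
    rw [← PrimeSpectrum.height_eq_orderHeight]
    exact H y.asIdeal y.isPrime hy
  rw [← PrimeSpectrum.height_eq_orderHeight] at this
  have := h.trans this
  norm_cast at this
  omega

theorem Ideal.add_height_le_height_comap_of_surjective (f : R →+* S)
    (hf : Function.Surjective f) (c : ℕ∞) (Q : Ideal S) [Q.IsPrime]
    (h : ∀ P : Ideal R, P.IsPrime → RingHom.ker f ≤ P → P ≤ Q.comap f → c ≤ P.height) :
    c + Q.height ≤ (Q.comap f).height := by
  refine ENat.add_le_of_forall_natCast_le fun n hn => ?_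
  induction n generalizing Q with
  | zero =>
    rw [Nat.cast_zero, add_zero]
    exact h _ inferInstance (Ideal.ker_le_comap f) le_rfl
  | succ n ih =>
    obtain ⟨Q', hQ', hlt, hn'⟩ := Ideal.exists_lt_of_add_one_le_height hn
    have h1 := ih Q' (fun P hP hk hle => h P hP hk (hle.trans (Ideal.comap_mono hlt.le))) hn'
    have hlt' : Q'.comap f < Q.comap f :=
      (Ideal.comap_mono hlt.le).lt_of_ne fun e =>
        hlt.ne (Ideal.comap_injective_of_surjective f hf e)
    refine le_trans ?_ (Ideal.height_add_one_le_of_lt_of_isPrime hlt')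
    rw [Nat.cast_add, Nat.cast_one, ← add_assoc]
    gcongr

theorem Ideal.height_under_le_height [Algebra R S] [Algebra.HasGoingDown R S] (P : Ideal S)
    [P.IsPrime] : (P.under R).height ≤ P.height := by
  refine ENat.forall_natCast_le_iff_le.mp fun n hn => ?_
  induction n generalizing P with
  | zero => simp
  | succ n ih =>
    obtain ⟨Q, hQ, hlt, hn'⟩ := Ideal.exists_lt_of_add_one_le_height hn
    obtain ⟨P', hlt', hP', hover⟩ :=
      Ideal.exists_ideal_lt_liesOver_of_lt (p := Q) (q := P.under R) P hlt
    have h1 := ih P' (by rwa [← P'.over_def Q])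
    refine le_trans ?_ (Ideal.height_add_one_le_of_lt_of_isPrime hlt')
    rw [Nat.cast_add, Nat.cast_one]
    gcongr

end Heights

section PolynomialExtension

open MvPolynomial

theorem MvPolynomial.map_C_isPrime {σ R : Type*} [CommRing R] (q : Ideal R) [q.IsPrime] :
    (q.map (C : R →+* MvPolynomial σ R)).IsPrime := by
  rw [← Ideal.mk_ker (I := q), ← MvPolynomial.ker_map]
  exact RingHom.ker_isPrime _

theorem MvPolynomial.comap_map_map_C {σ R S : Type*} [CommRing R] [CommRing S] (f : R →+* S)
    (q : Ideal S) :
    (q.map (C : S →+* MvPolynomial σ S)).comap (MvPolynomial.map f) =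
      (q.comap f).map (C : R →+* MvPolynomial σ R) := by
  ext F
  simp [MvPolynomial.mem_map_C_iff, coeff_map]

theorem MvPolynomial.comap_C_map_C {σ R : Type*} [CommRing R] (q : Ideal R) :
    (q.map (C : R →+* MvPolynomial σ R)).comap C = q := by
  ext x
  rw [Ideal.mem_comap, MvPolynomial.mem_map_C_iff]
  classical
  refine ⟨fun h => by simpa using h 0, fun h m => ?_⟩
  rw [coeff_C]
  split_ifs
  exacts [h, q.zero_mem]

theorem MvPolynomial.height_map_C_mono {R : Type*} [CommRing R] (q : Ideal R) [q.IsPrime]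
    {m n : ℕ} (h : m ≤ n) :
    (q.map (C : R →+* MvPolynomial (Fin m) R)).height ≤
      (q.map (C : R →+* MvPolynomial (Fin n) R)).height := by
  obtain ⟨d, rfl⟩ := Nat.exists_eq_add_of_le' h
  let e : MvPolynomial (Fin (d + m)) R ≃+* MvPolynomial (Fin d) (MvPolynomial (Fin m) R) :=
    ((renameEquiv R finSumFinEquiv.symm).trans (sumAlgEquiv R (Fin d) (Fin m))).toRingEquiv
  have he : (RingHomClass.toRingHom e).comp C = (C : MvPolynomial (Fin m) R →+* _).comp C := by
    ext x
    simp [e]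
  have hm : (q.map (C : R →+* MvPolynomial (Fin (d + m)) R)).map (RingHomClass.toRingHom e) =
      (q.map (C : R →+* MvPolynomial (Fin m) R)).map C := by
    rw [Ideal.map_map, Ideal.map_map, he]
  have := map_C_isPrime (σ := Fin m) q
  have := map_C_isPrime (σ := Fin d) (q.map (C : R →+* MvPolynomial (Fin m) R))
  have h1 := Ideal.height_under_le_height (R := MvPolynomial (Fin m) R)
    ((q.map (C : R →+* MvPolynomial (Fin m) R)).map (C (σ := Fin d)))
  rw [Ideal.under_def, MvPolynomial.algebraMap_eq, comap_C_map_C, ← hm] at h1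
  exact h1.trans (RingEquiv.height_map e _).le

end PolynomialExtension

section Relations

open MvPolynomial

variable {E D : Type*} [CommRing E] [CommRing D] [Algebra E D]

theorem transcendental_adjoin_range_of_ker_le {σ : Type*} (x : σ → D) (a : D)
    (h : RingHom.ker (Polynomial.eval₂RingHom (aeval x : MvPolynomial σ E →ₐ[E] D).toRingHom a) ≤
      (RingHom.ker (aeval x : MvPolynomial σ E →ₐ[E] D).toRingHom).map Polynomial.C) :
    Transcendental (Algebra.adjoin E (Set.range x)) a := by
  rw [transcendental_iff]
  intro p hp
  have hmem : ∀ i, ∃ F : MvPolynomial σ E, aeval x F = (p.coeff i : D) := fun i => by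
    have hi := (p.coeff i).2
    generalize (p.coeff i : D) = c at hi ⊢
    rwa [Algebra.adjoin_range_eq_range_aeval] at hi
  choose F hF using hmem
  let G : Polynomial (MvPolynomial σ E) := ∑ i ∈ p.support, Polynomial.monomial i (F i)
  have hG : Polynomial.eval₂RingHom (aeval x : MvPolynomial σ E →ₐ[E] D).toRingHom a G = 0 := by
    rw [← hp, Polynomial.aeval_def, Polynomial.eval₂_eq_sum, Polynomial.sum, map_sum]
    refine Finset.sum_congr rfl fun i _ => ?_
    simp [Polynomial.eval₂_monomial, hF]
  have h2 := h (RingHom.mem_ker.mpr hG)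
  rw [Ideal.mem_map_C_iff] at h2
  ext i
  by_cases hi : i ∈ p.support
  · have := h2 i
    rw [RingHom.mem_ker, Polynomial.finsetSum_coeff, Finset.sum_eq_single i] at this
    · simpa [hF] using this
    · intro j _ hj
      rw [Polynomial.coeff_monomial, if_neg hj]
    · exact fun h => absurd hi h
  · simpa using hi

variable [IsDomain E] [IsDomain D] [FaithfulSMul E D]

theorem exists_algebraicIndepOn_le_height_ker_aeval_add_encard (m : ℕ)
    (x : Fin m → D) :
    ∃ t ⊆ Set.range x, AlgebraicIndepOn E id t ∧
      (m : ℕ∞) ≤ (RingHom.ker (aeval x : MvPolynomial (Fin m) E →ₐ[E] D).toRingHom).height +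
        t.encard := by
  induction m with
  | zero =>
    refine ⟨∅, Set.empty_subset _, ?_, by simp⟩
    exact algebraicIndependent_empty_type_iff.mpr (FaithfulSMul.algebraMap_injective E D)
  | succ m ih =>
    obtain ⟨t, htx, ht, hle⟩ := ih (Fin.tail x)
    set φ : MvPolynomial (Fin m) E →+* D :=
      (aeval (Fin.tail x) : MvPolynomial (Fin m) E →ₐ[E] D).toRingHom with hφ
    set Q := RingHom.ker (Polynomial.eval₂RingHom φ (x 0)) with hQ
    have hcomp : (Polynomial.eval₂RingHom φ (x 0)).comp
        (RingHomClass.toRingHom (finSuccEquiv E m).toRingEquiv) =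
        (aeval x : MvPolynomial (Fin (m + 1)) E →ₐ[E] D).toRingHom := by
      ext i
      · simp [hφ, MvPolynomial.finSuccEquiv_apply]
      · refine Fin.cases ?_ (fun i => ?_) i
        · simp [MvPolynomial.finSuccEquiv_apply]
        · simp [hφ, Fin.tail, MvPolynomial.finSuccEquiv_apply]
    have hker : (RingHom.ker (aeval x : MvPolynomial (Fin (m + 1)) E →ₐ[E] D).toRingHom).height =
        Q.height := by
      rw [← hcomp, ← RingHom.comap_ker]
      exact RingEquiv.height_comap (finSuccEquiv E m).toRingEquiv Q
    have hQC : Q.comap Polynomial.C = RingHom.ker φ := by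
      rw [hQ, RingHom.comap_ker]
      congr 1
      ext <;> simp
    have hpr : (RingHom.ker φ).IsPrime := RingHom.ker_isPrime _
    have hpr' : Q.IsPrime := RingHom.ker_isPrime _
    have hprC := Ideal.isPrime_map_C_of_isPrime (P := RingHom.ker φ)
    have hsub : (RingHom.ker φ).map Polynomial.C ≤ Q := by
      rw [Ideal.map_le_iff_le_comap, hQC]
    rw [hker]
    have hht : (RingHom.ker φ).height ≤ ((RingHom.ker φ).map Polynomial.C).height := by
      have h1 := Ideal.height_under_le_height (R := MvPolynomial (Fin m) E)
        ((RingHom.ker φ).map Polynomial.C)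
      refine le_trans (Ideal.height_mono ?_) h1
      rw [Ideal.under_def, Polynomial.algebraMap_eq, ← Ideal.map_le_iff_le_comap]
    have hrange : Set.range (Fin.tail x) ⊆ Set.range x := by
      rintro _ ⟨i, rfl⟩
      exact ⟨_, rfl⟩
    rcases hsub.eq_or_lt with heq | hlt
    · have htr : Transcendental (Algebra.adjoin E (Set.range (Fin.tail x))) (x 0) :=
        transcendental_adjoin_range_of_ker_le _ _ heq.ge
      have hadj : Algebra.adjoin E (id '' t) ≤ Algebra.adjoin E (Set.range (Fin.tail x)) :=
        Algebra.adjoin_mono (by simpa using htx)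
      have htr' : Transcendental (Algebra.adjoin E (id '' t)) (x 0) :=
        htr.of_ringHom_of_comp_eq (Subalgebra.inclusion hadj) (RingHom.id D)
          (Subalgebra.inclusion_injective hadj) rfl
      refine ⟨insert (x 0) t, ?_, ht.insert htr', ?_⟩
      · exact Set.insert_subset ⟨0, rfl⟩ (htx.trans hrange)
      · have hnot : x 0 ∉ t := fun hmem => htr' <|
          isAlgebraic_algebraMap (⟨x 0, Algebra.subset_adjoin ⟨_, hmem, rfl⟩⟩ :
            Algebra.adjoin E (id '' t))
        rw [Set.encard_insert_of_notMem hnot, ← add_assoc, Nat.cast_add, Nat.cast_one]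
        gcongr
        exact hle.trans (by gcongr; exact hht.trans (Ideal.height_mono heq.le))
    · refine ⟨t, htx.trans hrange, ht, ?_⟩
      rw [Nat.cast_add, Nat.cast_one]
      calc (m : ℕ∞) + 1 ≤ ((RingHom.ker φ).height + t.encard) + 1 := by gcongr
        _ = (RingHom.ker φ).height + 1 + t.encard := by ring
        _ ≤ _ := by
          gcongr
          exact le_trans (by gcongr) (Ideal.height_add_one_le_of_lt_of_isPrime hlt)

theorem le_height_ker_aeval_add_toENat_trdeg {m : ℕ} (x : Fin m → D) :
    (m : ℕ∞) ≤ (RingHom.ker (aeval x : MvPolynomial (Fin m) E →ₐ[E] D).toRingHom).height +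
        Cardinal.toENat (Algebra.trdeg E D) := by
  obtain ⟨t, -, ht, hle⟩ := exists_algebraicIndepOn_le_height_ker_aeval_add_encard (E := E) m x
  refine hle.trans ?_
  gcongr
  exact Cardinal.toENat.monotone' ht.cardinalMk_le_trdeg

end Relations

section TranscendenceDegreeStep

open MvPolynomial

variable {E D : Type*} [CommRing E] [CommRing D] [Algebra E D] [IsDomain E] [IsDomain D]

theorem add_one_le_toENat_trdeg_of_comap_aeval_eq_bot {u : ℕ} (P : Ideal D) (hP : P ≠ ⊥)
    (a : Fin u → D)
    (ha : P.comap (aeval a : MvPolynomial (Fin u) E →ₐ[E] D).toRingHom = ⊥) :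
    (u : ℕ∞) + 1 ≤ Cardinal.toENat (Algebra.trdeg E D) := by
  have hind : AlgebraicIndependent E a := by
    rw [algebraicIndependent_iff_injective_aeval]
    refine (injective_iff_map_eq_zero' (aeval a : MvPolynomial (Fin u) E →ₐ[E] D)).mpr
      fun F => ⟨fun h => ?_, fun h => by rw [h, map_zero]⟩
    have : F ∈ P.comap (aeval a : MvPolynomial (Fin u) E →ₐ[E] D).toRingHom := by
      rw [Ideal.mem_comap]
      exact h ▸ P.zero_mem
    rwa [ha] at this
  obtain ⟨y, hy, hy0⟩ := Submodule.exists_mem_ne_zero_of_ne_bot hP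
  have htr : Transcendental (Algebra.adjoin E (Set.range a)) y := by
    intro halg
    obtain ⟨r, hr0, z, hz⟩ := halg.exists_nonzero_dvd (mem_nonZeroDivisors_of_ne_zero hy0)
    have hr : (r : D) ∈ P := by
      change algebraMap _ D r ∈ P
      rw [hz]
      exact P.mul_mem_right _ hy
    have hr' := r.2
    refine hr0 (Subtype.ext ?_)
    change (r : D) = 0
    generalize (r : D) = c at hr hr' ⊢
    rw [Algebra.adjoin_range_eq_range_aeval] at hr'
    obtain ⟨F, rfl⟩ := hr'
    have : F ∈ P.comap (aeval a : MvPolynomial (Fin u) E →ₐ[E] D).toRingHom := hr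
    rw [ha] at this
    rw [(Submodule.mem_bot _).mp this]
    exact map_zero _
  have h := ((hind.option_iff_transcendental y).mpr htr).lift_cardinalMk_le_trdeg
  have h2 := Cardinal.toENat.monotone' h
  simpa using h2

theorem add_one_le_height_map_C_add_toENat_trdeg [FaithfulSMul E D] {u n : ℕ} (hun : u ≤ n)
    (P : Ideal D) [P.IsPrime] (hP : P ≠ ⊥) (a : Fin u → D)
    (ha : P.comap (aeval a : MvPolynomial (Fin u) E →ₐ[E] D).toRingHom ≤ (P.under E).map C) :
    (u : ℕ∞) + 1 ≤ ((P.under E).map (C : E →+* MvPolynomial (Fin n) E)).height +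
      Cardinal.toENat (Algebra.trdeg E D) := by
  by_cases hq : P.under E = ⊥
  · refine le_add_left (add_one_le_toENat_trdeg_of_comap_aeval_eq_bot P hP a ?_)
    rwa [hq, Ideal.map_bot, le_bot_iff] at ha
  · obtain ⟨c, hc, hc0⟩ := Submodule.exists_mem_ne_zero_of_ne_bot hq
    have := MvPolynomial.map_C_isPrime (σ := Fin u) (P.under E)
    have : (RingHom.ker (aeval a : MvPolynomial (Fin u) E →ₐ[E] D).toRingHom).IsPrime :=
      RingHom.ker_isPrime _
    have hlt : RingHom.ker (aeval a : MvPolynomial (Fin u) E →ₐ[E] D).toRingHom <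
        (P.under E).map C := by
      refine lt_of_le_of_ne ((Ideal.ker_le_comap _).trans ha) fun heq => ?_
      have hmem : (C c : MvPolynomial (Fin u) E) ∈ (P.under E).map C := Ideal.mem_map_of_mem _ hc
      rw [← heq, RingHom.mem_ker] at hmem
      have : algebraMap E D c = 0 := by simpa using hmem
      exact hc0 ((FaithfulSMul.algebraMap_eq_zero_iff E D).mp this)
    calc (u : ℕ∞) + 1
        ≤ (RingHom.ker (aeval a : MvPolynomial (Fin u) E →ₐ[E] D).toRingHom).height +
          Cardinal.toENat (Algebra.trdeg E D) + 1 := by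
          gcongr
          exact le_height_ker_aeval_add_toENat_trdeg a
      _ = (RingHom.ker (aeval a : MvPolynomial (Fin u) E →ₐ[E] D).toRingHom).height + 1 +
          Cardinal.toENat (Algebra.trdeg E D) := by ring
      _ ≤ _ := by
          gcongr
          exact (Ideal.height_add_one_le_of_lt_of_isPrime hlt).trans
            (MvPolynomial.height_map_C_mono _ hun)

end TranscendenceDegreeStep

theorem exists_fin_isTranscendenceBasis {R A : Type*} [CommRing R] [CommRing A] [Algebra R A]
    [Nontrivial R] [NoZeroDivisors A] [FaithfulSMul R A] {u : ℕ}
    (h : Cardinal.toENat (Algebra.trdeg R A) = u) :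
    ∃ a : Fin u → A, IsTranscendenceBasis R a := by
  obtain ⟨ι, x, hx⟩ := exists_isTranscendenceBasis' R A
  rw [← hx.cardinalMk_eq_trdeg, Cardinal.toENat_eq_natCast] at h
  obtain ⟨e⟩ := Cardinal.mk_eq_nat_iff.mp h
  exact ⟨x ∘ e.symm, (isTranscendenceBasis_equiv e.symm).mpr hx⟩

section ResidueTranscendenceDegree

open MvPolynomial

variable {S : Type*} (B : Type*) [CommRing B] [CommRing S] [Algebra B S]

/-- Transcendence degree of `S ⧸ P` over `B ⧸ (P ∩ B)`, as an extended natural number. -/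
def Ideal.residueTrdeg (P : Ideal S) : ℕ∞ :=
  Cardinal.toENat (Algebra.trdeg (B ⧸ P.under B) (S ⧸ P))

theorem Ideal.residueTrdeg_add_one_le_of_lt {n u : ℕ} (hun : u ≤ n) {P' P : Ideal S}
    [P'.IsPrime] [P.IsPrime] (hlt : P' < P) (hu : P.residueTrdeg B = u) :
    (u : ℕ∞) + 1 ≤
      (((P.under B).map (Ideal.Quotient.mk (P'.under B))).map
        (C : _ →+* MvPolynomial (Fin n) (B ⧸ P'.under B))).height + P'.residueTrdeg B := by
  obtain ⟨b, hb⟩ := exists_fin_isTranscendenceBasis hu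
  choose a ha using fun i => Ideal.Quotient.mk_surjective (b i)
  have hcomap : (P.map (Ideal.Quotient.mk P')).comap (Ideal.Quotient.mk P') = P := by
    rw [Ideal.comap_map_of_surjective _ Ideal.Quotient.mk_surjective, ← RingHom.ker_eq_comap_bot,
      Ideal.mk_ker, sup_of_le_left hlt.le]
  have hprime : (P.map (Ideal.Quotient.mk P')).IsPrime :=
    Ideal.map_isPrime_of_surjective Ideal.Quotient.mk_surjective
      (by rw [Ideal.mk_ker]; exact hlt.le)
  have hmem : ∀ y : S, Ideal.Quotient.mk P' y ∈ P.map (Ideal.Quotient.mk P') ↔ y ∈ P := fun y => by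
    rw [← Ideal.mem_comap, hcomap]
  have hne : P.map (Ideal.Quotient.mk P') ≠ ⊥ := by
    intro h
    rw [h, ← RingHom.ker_eq_comap_bot, Ideal.mk_ker] at hcomap
    exact hlt.ne hcomap
  have hmemE : ∀ c : B, Ideal.Quotient.mk (P'.under B) c ∈
      (P.map (Ideal.Quotient.mk P')).under (B ⧸ P'.under B) ↔ c ∈ P.under B := fun c => by
    rw [Ideal.mem_under, Ideal.Quotient.algebraMap_mk_of_liesOver, hmem, Ideal.mem_under]
  have hunder : (P.map (Ideal.Quotient.mk P')).under (B ⧸ P'.under B) =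
      (P.under B).map (Ideal.Quotient.mk (P'.under B)) := by
    apply Ideal.comap_injective_of_surjective _ (Ideal.Quotient.mk_surjective (I := P'.under B))
    rw [Ideal.comap_map_of_surjective _ Ideal.Quotient.mk_surjective, ← RingHom.ker_eq_comap_bot,
      Ideal.mk_ker, sup_of_le_left (Ideal.comap_mono hlt.le)]
    ext c
    rw [Ideal.mem_comap, hmemE]
  rw [← hunder]
  refine add_one_le_height_map_C_add_toENat_trdeg hun _ hne
    (fun i => Ideal.Quotient.mk P' (a i)) fun F hF => ?_
  obtain ⟨G, rfl⟩ := MvPolynomial.map_surjective (Ideal.Quotient.mk (P'.under B))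
    Ideal.Quotient.mk_surjective F
  rw [MvPolynomial.mem_map_C_iff]
  intro m
  rw [coeff_map, hmemE]
  have h1 : (aeval fun i => Ideal.Quotient.mk P' (a i))
      (MvPolynomial.map (Ideal.Quotient.mk (P'.under B)) G) =
      Ideal.Quotient.mk P' (aeval a G) := by
    rw [aeval_def, eval₂_map, aeval_def, ← MvPolynomial.coe_eval₂Hom, ← MvPolynomial.coe_eval₂Hom,
      ← RingHom.comp_apply]
    congr 1
    ext <;> simp
  have h2 : aeval b (MvPolynomial.map (Ideal.Quotient.mk (P.under B)) G) =
      Ideal.Quotient.mk P (aeval a G) := by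
    rw [aeval_def, eval₂_map, aeval_def, ← MvPolynomial.coe_eval₂Hom, ← MvPolynomial.coe_eval₂Hom,
      ← RingHom.comp_apply]
    congr 1
    ext <;> simp [ha]
  have h3 : aeval a G ∈ P := by
    rw [← hmem, ← h1]
    exact hF
  rw [Ideal.Quotient.eq_zero_iff_mem.mpr h3] at h2
  have h4 := (map_eq_zero_iff _ (algebraicIndependent_iff_injective_aeval.mp hb.1)).mp h2
  rw [← Ideal.Quotient.eq_zero_iff_mem, ← coeff_map, h4, coeff_zero]

theorem Ideal.height_add_residueTrdeg_le {n : ℕ}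
    (hn : ∀ P : Ideal S, P.IsPrime → P.residueTrdeg B ≤ n) (P : Ideal S) [P.IsPrime] :
    P.residueTrdeg B + P.height ≤
      ((P.under B).map (C : B →+* MvPolynomial (Fin n) B)).height + n := by
  refine ENat.add_le_of_forall_natCast_le fun l hl => ?_
  induction l generalizing P with
  | zero => simpa using le_add_left (hn P inferInstance)
  | succ l ih =>
    obtain ⟨P', hP', hlt, hl'⟩ := Ideal.exists_lt_of_add_one_le_height hl
    have h1 := ih P' hl'
    have hfin : P'.residueTrdeg B ≠ ⊤ := ne_top_of_le_ne_top (ENat.natCast_ne_top n) (hn P' hP')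
    obtain ⟨u, hu⟩ := ENat.ne_top_iff_exists.mp
      (ne_top_of_le_ne_top (ENat.natCast_ne_top n) (hn P inferInstance))
    have hun : u ≤ n := by exact_mod_cast hu.trans_le (hn P inferInstance)
    have h2 := Ideal.residueTrdeg_add_one_le_of_lt B hun hlt hu.symm
    have hle : P'.under B ≤ P.under B := Ideal.comap_mono hlt.le
    have hprime : ((P.under B).map (Ideal.Quotient.mk (P'.under B))).IsPrime :=
      Ideal.map_isPrime_of_surjective Ideal.Quotient.mk_surjective (by rwa [Ideal.mk_ker])
    have := MvPolynomial.map_C_isPrime (σ := Fin n)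
      ((P.under B).map (Ideal.Quotient.mk (P'.under B)))
    have h3 := Ideal.add_height_le_height_comap_of_surjective
      (MvPolynomial.map (σ := Fin n) (Ideal.Quotient.mk (P'.under B)))
      (MvPolynomial.map_surjective _ Ideal.Quotient.mk_surjective)
      ((P'.under B).map (C : B →+* MvPolynomial (Fin n) B)).height
      (((P.under B).map (Ideal.Quotient.mk (P'.under B))).map C)
      fun J _ hJ _ => Ideal.height_mono (by rwa [MvPolynomial.ker_map, Ideal.mk_ker] at hJ)
    rw [MvPolynomial.comap_map_map_C, Ideal.comap_map_of_surjective _ Ideal.Quotient.mk_surjective,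
      ← RingHom.ker_eq_comap_bot, Ideal.mk_ker, sup_of_le_left hle] at h3
    rw [← ENat.add_le_add_iff_right hfin, ← hu]
    calc (u : ℕ∞) + ((l + 1 : ℕ) : ℕ∞) + P'.residueTrdeg B
        = (P'.residueTrdeg B + l) + (u + 1) := by push_cast; ring
      _ ≤ _ := add_le_add h1 h2
      _ = (((P'.under B).map (C : B →+* MvPolynomial (Fin n) B)).height +
          (((P.under B).map (Ideal.Quotient.mk (P'.under B))).map
            (C : _ →+* MvPolynomial (Fin n) (B ⧸ P'.under B))).height) +
          n + P'.residueTrdeg B := by ring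
      _ ≤ _ := by gcongr

end ResidueTranscendenceDegree

theorem RingHom.Flat.of_injective_of_field {R K : Type*} [CommRing R] [IsDomain R] [Field K]
    {f : R →+* K} (hf : Function.Injective f) : f.Flat := by
  have h1 : (algebraMap R (FractionRing R)).Flat := by
    rw [RingHom.flat_algebraMap_iff]
    exact IsLocalization.flat _ (nonZeroDivisors R)
  have h2 : (IsFractionRing.lift hf : FractionRing R →+* K).Flat :=
    RingHom.Flat.of_isField (Field.toIsField _) _
  have h3 : (IsFractionRing.lift hf : FractionRing R →+* K).comp (algebraMap R (FractionRing R)) =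
      f := by
    ext
    simp
  exact h3 ▸ h1.comp h2

theorem RingHom.Flat.height_comap_le {R S : Type*} [CommRing R] [CommRing S] {f : R →+* S}
    (hf : f.Flat) (P : Ideal S) [P.IsPrime] : (P.comap f).height ≤ P.height := by
  algebraize [f]
  exact Ideal.height_under_le_height P

section TensorProduct

open MvPolynomial Algebra.TensorProduct

variable {k A B : Type*} [Field k] [CommRing A] [CommRing B] [Algebra k A] [Algebra k B]

variable (k B) in
/-- The `B`-algebra evaluation map `B[X] → A ⊗ B` at a family of elements of `A`. -/
def mvPolynomialToTensor {σ : Type*} (x : σ → A) : MvPolynomial σ B →+* A ⊗[k] B :=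
  eval₂Hom (includeRight : B →ₐ[k] A ⊗[k] B).toRingHom
    fun i => (includeLeft : A →ₐ[k] A ⊗[k] B) (x i)

theorem flat_mvPolynomialToTensor_of_injective {K : Type*} [Field K] [Algebra k K] {σ : Type*}
    (x : σ → K) (hx : AlgebraicIndependent k x) : (mvPolynomialToTensor k B x).Flat := by
  have h1 : (Algebra.TensorProduct.map (aeval x : MvPolynomial σ k →ₐ[k] K)
      (AlgHom.id k B)).toRingHom.Flat := by
    refine RingHom.Flat.tensorProductMap (S := k) ?_ (RingHom.Flat.id _)
    exact RingHom.Flat.of_injective_of_field (algebraicIndependent_iff_injective_aeval.mp hx)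
  let e : MvPolynomial σ B ≃+* MvPolynomial σ k ⊗[k] B :=
    (algebraTensorAlgEquiv k B).symm.toRingEquiv.trans
      (Algebra.TensorProduct.comm k B (MvPolynomial σ k)).toRingEquiv
  have h2 : (RingHomClass.toRingHom e).Flat := RingHom.Flat.of_bijective e.bijective
  have hC : ∀ b : B, (algebraTensorAlgEquiv (σ := σ) k B).symm (C b) = b ⊗ₜ 1 :=
    (algebraTensorAlgEquiv (σ := σ) k B).symm.commutes
  have h3 : (Algebra.TensorProduct.map (aeval x : MvPolynomial σ k →ₐ[k] K)
      (AlgHom.id k B)).toRingHom.comp (RingHomClass.toRingHom e) = mvPolynomialToTensor k B x := by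
    ext <;> simp [e, hC, mvPolynomialToTensor]
  exact h3 ▸ h2.comp h1

theorem height_comap_mvPolynomialToTensor_le [IsDomain A] {σ : Type*} (x : σ → A)
    (hx : AlgebraicIndependent k x) (P : Ideal (A ⊗[k] B)) [P.IsPrime]
    (hP : P.comap (includeLeft : A →ₐ[k] A ⊗[k] B).toRingHom = ⊥) :
    (P.comap (mvPolynomialToTensor k B x)).height ≤ P.height := by
  let K := FractionRing A
  let f : A ⊗[k] B →ₐ[k] K ⊗[k] B :=
    Algebra.TensorProduct.map (IsScalarTower.toAlgHom k A K) (AlgHom.id k B)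
  let : Algebra (A ⊗[k] B) (K ⊗[k] B) := f.toRingHom.toAlgebra
  have hf : algebraMap (A ⊗[k] B) (K ⊗[k] B) = f.toRingHom := rfl
  have : IsScalarTower A (A ⊗[k] B) (K ⊗[k] B) := by
    refine IsScalarTower.of_algebraMap_eq fun a => ?_
    rw [hf]
    simp only [Algebra.TensorProduct.algebraMap_apply, AlgHom.toRingHom_eq_coe, RingHom.coe_coe, f,
      Algebra.TensorProduct.map_tmul, map_one]
    rfl
  have hloc : IsLocalization
      (Algebra.algebraMapSubmonoid (A ⊗[k] B) (nonZeroDivisors A)) (K ⊗[k] B) := by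
    refine IsLocalization.tensorProduct_tensorProduct k B (nonZeroDivisors A) K ?_
    rw [hf]
    ext b
    simp [f]
  have hdisj : Disjoint (Algebra.algebraMapSubmonoid (A ⊗[k] B) (nonZeroDivisors A) : Set _)
      (P : Set (A ⊗[k] B)) := by
    rw [Set.disjoint_left]
    rintro _ ⟨a, ha, rfl⟩ haP
    have : a ∈ P.comap (includeLeft : A →ₐ[k] A ⊗[k] B).toRingHom := haP
    rw [hP] at this
    exact nonZeroDivisors.ne_zero ha this
  have hprime := IsLocalization.isPrime_of_isPrime_disjoint _ (K ⊗[k] B) P inferInstance hdisj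
  have hunder := IsLocalization.under_map_of_isPrime_disjoint _ (K ⊗[k] B) (I := P)
    inferInstance hdisj
  rw [← IsLocalization.height_map_of_disjoint (S := K ⊗[k] B) _ P hdisj]
  have hx' : AlgebraicIndependent k (algebraMap A K ∘ x) :=
    hx.map' (f := IsScalarTower.toAlgHom k A K) (IsFractionRing.injective A K)
  have hcomp : (algebraMap (A ⊗[k] B) (K ⊗[k] B)).comp (mvPolynomialToTensor k B x) =
      mvPolynomialToTensor k B (algebraMap A K ∘ x) := by
    rw [hf]
    ext <;> simp [f, mvPolynomialToTensor]
  have h := (flat_mvPolynomialToTensor_of_injective (B := B) _ hx').height_comap_le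
    (P.map (algebraMap (A ⊗[k] B) (K ⊗[k] B)))
  rwa [← hcomp, ← Ideal.comap_comap, ← Ideal.under_def, hunder] at h

end TensorProduct

theorem Ideal.exists_isPrime_comap_eq_of_ker_le {R S : Type*} [CommRing R] [CommRing S]
    {f : R →+* S} (hf : Function.Surjective f) {P : Ideal R} [P.IsPrime]
    (h : RingHom.ker f ≤ P) : ∃ Q : Ideal S, Q.IsPrime ∧ Q.comap f = P :=
  ⟨P.map f, Ideal.map_isPrime_of_surjective hf h, by
    rw [Ideal.comap_map_of_surjective f hf, ← RingHom.ker_eq_comap_bot, sup_of_le_left h]⟩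

section TensorProductHeights

open MvPolynomial Algebra.TensorProduct

variable {k A B : Type*} [Field k] [CommRing A] [CommRing B] [Algebra k A] [Algebra k B]

theorem map_C_le_comap_mvPolynomialToTensor {σ : Type*} (x : σ → A) {P : Ideal (A ⊗[k] B)}
    {q : Ideal B} (h : q ≤ P.comap (includeRight : B →ₐ[k] A ⊗[k] B).toRingHom) :
    q.map C ≤ P.comap (mvPolynomialToTensor k B x) := by
  rw [Ideal.map_le_iff_le_comap]
  intro b hb
  rw [Ideal.mem_comap, Ideal.mem_comap, mvPolynomialToTensor, coe_eval₂Hom, eval₂_C]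
  exact h hb

theorem ker_lTensor_mk_le {q : Ideal B} {P : Ideal (A ⊗[k] B)}
    (h : q ≤ P.comap (includeRight : B →ₐ[k] A ⊗[k] B).toRingHom) :
    RingHom.ker (Algebra.TensorProduct.map (AlgHom.id k A) (Ideal.Quotient.mkₐ k q)).toRingHom ≤
      P := by
  have := lTensor_ker (A := A) (Ideal.Quotient.mkₐ k q) Ideal.Quotient.mk_surjective
  refine (le_of_eq this).trans ?_
  rw [Ideal.map_le_iff_le_comap]
  refine le_trans (le_of_eq ?_) h
  exact Ideal.Quotient.mkₐ_ker k q

theorem height_comap_includeLeft_le (P : Ideal (A ⊗[k] B)) [P.IsPrime] :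
    (P.comap (includeLeft : A →ₐ[k] A ⊗[k] B).toRingHom).height ≤ P.height :=
  Ideal.height_under_le_height (R := A) P

variable [IsDomain A] {n : ℕ} {x : Fin n → A}

theorem height_map_C_comap_includeRight_le (hx : AlgebraicIndependent k x)
    (P : Ideal (A ⊗[k] B)) [P.IsPrime] :
    ((P.comap (includeRight : B →ₐ[k] A ⊗[k] B).toRingHom).map
      (C : B →+* MvPolynomial (Fin n) B)).height ≤ P.height := by
  set q := P.comap (includeRight : B →ₐ[k] A ⊗[k] B).toRingHom with hq
  set π := (Algebra.TensorProduct.map (AlgHom.id k A) (Ideal.Quotient.mkₐ k q)).toRingHom with hπ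
  have hsurj : Function.Surjective π :=
    TensorProduct.map_surjective Function.surjective_id Ideal.Quotient.mk_surjective
  obtain ⟨Q, hQ, hQP⟩ := Ideal.exists_isPrime_comap_eq_of_ker_le hsurj (ker_lTensor_mk_le hq.le)
  have hbot : (⊥ : Ideal A).IsPrime := Ideal.isPrime_bot
  obtain ⟨Q', hle, hQ', hover⟩ := Ideal.exists_ideal_le_liesOver_of_le (p := (⊥ : Ideal A))
    (q := Q.under A) Q bot_le
  have hle' : Q'.comap π ≤ P := hQP ▸ Ideal.comap_mono hle
  have hl : (Q'.comap π).comap (includeLeft : A →ₐ[k] A ⊗[k] B).toRingHom = ⊥ := by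
    rw [hover.over, Ideal.comap_comap]
    congr 1
  have hr : q ≤ (Q'.comap π).comap (includeRight : B →ₐ[k] A ⊗[k] B).toRingHom := by
    intro b hb
    have h0 : Ideal.Quotient.mk q b = 0 := Ideal.Quotient.eq_zero_iff_mem.mpr hb
    simp [Ideal.mem_comap, hπ, h0]
  exact (Ideal.height_mono (map_C_le_comap_mvPolynomialToTensor x hr)).trans <|
    (height_comap_mvPolynomialToTensor_le x hx _ hl).trans (Ideal.height_mono hle')

theorem height_map_C_add_height_comap_includeLeft_le (hx : AlgebraicIndependent k x)
    (P : Ideal (A ⊗[k] B)) [P.IsPrime] :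
    ((P.comap (includeRight : B →ₐ[k] A ⊗[k] B).toRingHom).map
      (C : B →+* MvPolynomial (Fin n) B)).height +
      (P.comap (includeLeft : A →ₐ[k] A ⊗[k] B).toRingHom).height ≤ P.height := by
  set q := P.comap (includeRight : B →ₐ[k] A ⊗[k] B).toRingHom with hq
  set π := (Algebra.TensorProduct.map (AlgHom.id k A) (Ideal.Quotient.mkₐ k q)).toRingHom with hπ
  have hsurj : Function.Surjective π :=
    TensorProduct.map_surjective Function.surjective_id Ideal.Quotient.mk_surjective
  obtain ⟨Q, hQ, hQP⟩ := Ideal.exists_isPrime_comap_eq_of_ker_le hsurj (ker_lTensor_mk_le hq.le)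
  have hl : P.comap (includeLeft : A →ₐ[k] A ⊗[k] B).toRingHom =
      Q.comap (includeLeft : A →ₐ[k] A ⊗[k] (B ⧸ q)).toRingHom := by
    rw [← hQP, Ideal.comap_comap]
    congr 1
  rw [hl]
  refine (add_le_add_right (height_comap_includeLeft_le Q) _).trans ?_
  rw [← hQP]
  refine Ideal.add_height_le_height_comap_of_surjective π hsurj _ Q fun P' hP' hker _ => ?_
  refine le_trans (Ideal.height_mono (Ideal.map_mono ?_))
    (height_map_C_comap_includeRight_le hx P')
  intro b hb
  refine hker ?_
  have h0 : Ideal.Quotient.mk q b = 0 := Ideal.Quotient.eq_zero_iff_mem.mpr hb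
  simp [RingHom.mem_ker, hπ, h0]

theorem height_map_C_add_height_add_height_le (hx : AlgebraicIndependent k x)
    (p : Ideal A) (q : Ideal B) (Q : Ideal ((A ⧸ p) ⊗[k] (B ⧸ q))) [Q.IsPrime] :
    (q.map (C : B →+* MvPolynomial (Fin n) B)).height + p.height + Q.height ≤
      (Q.comap (Algebra.TensorProduct.map (Ideal.Quotient.mkₐ k p)
        (Ideal.Quotient.mkₐ k q)).toRingHom).height := by
  refine Ideal.add_height_le_height_comap_of_surjective _
    (TensorProduct.map_surjective Ideal.Quotient.mk_surjective Ideal.Quotient.mk_surjective)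
    _ Q fun P' hP' hker _ => ?_
  refine le_trans (add_le_add (Ideal.height_mono (Ideal.map_mono fun b hb => hker ?_))
    (Ideal.height_mono fun a ha => hker ?_)) (height_map_C_add_height_comap_includeLeft_le hx P')
  · have h0 : Ideal.Quotient.mk q b = 0 := Ideal.Quotient.eq_zero_iff_mem.mpr hb
    simp [RingHom.mem_ker, h0]
  · have h0 : Ideal.Quotient.mk p a = 0 := Ideal.Quotient.eq_zero_iff_mem.mpr ha
    simp [RingHom.mem_ker, h0]

end TensorProductHeights

section ResidueTranscendenceDegreeTensorProduct

open MvPolynomial Algebra.TensorProduct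

attribute [local instance] Algebra.TensorProduct.rightAlgebra

variable {k A B : Type*} [Field k] [CommRing A] [CommRing B] [Algebra k A] [Algebra k B]
  (P : Ideal (A ⊗[k] B)) {s : ℕ} {x : Fin s → A ⧸ P.under A}

theorem algebraMap_mem_adjoin_range_of_mem_adjoin_range {z : A ⧸ P.under A}
    (hz : z ∈ Algebra.adjoin k (Set.range x)) :
    algebraMap (A ⧸ P.under A) (A ⊗[k] B ⧸ P) z ∈
      Algebra.adjoin (B ⧸ P.under B)
        (Set.range fun i => algebraMap (A ⧸ P.under A) (A ⊗[k] B ⧸ P) (x i)) := by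
  induction hz using Algebra.adjoin_induction with
  | mem z hz =>
    obtain ⟨i, rfl⟩ := hz
    exact Algebra.subset_adjoin ⟨i, rfl⟩
  | algebraMap r =>
    have : algebraMap (A ⧸ P.under A) (A ⊗[k] B ⧸ P) (algebraMap k _ r) =
        algebraMap (B ⧸ P.under B) (A ⊗[k] B ⧸ P)
          (Ideal.Quotient.mk _ (algebraMap k B r)) := by
      change Ideal.Quotient.mk P (algebraMap k A r ⊗ₜ 1) =
        Ideal.Quotient.mk P (1 ⊗ₜ algebraMap k B r)
      rw [Algebra.algebraMap_eq_smul_one, Algebra.algebraMap_eq_smul_one, smul_tmul]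
    rw [this]
    exact Subalgebra.algebraMap_mem _ _
  | add y z _ _ hy hz => rw [map_add]; exact add_mem hy hz
  | mul y z _ _ hy hz => rw [map_mul]; exact mul_mem hy hz

variable [P.IsPrime]

theorem isAlgebraic_quotient_of_isTranscendenceBasis (hx : IsTranscendenceBasis k x) :
    Algebra.IsAlgebraic (Algebra.adjoin (B ⧸ P.under B)
      (Set.range fun i => algebraMap (A ⧸ P.under A) (A ⊗[k] B ⧸ P) (x i))) (A ⊗[k] B ⧸ P) := by
  set g := algebraMap (A ⧸ P.under A) (A ⊗[k] B ⧸ P)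
  set R := Algebra.adjoin (B ⧸ P.under B) (Set.range fun i => g (x i))
  have hg : Function.Injective g := FaithfulSMul.algebraMap_injective _ _
  let f : Algebra.adjoin k (Set.range x) →+* R :=
    (g.comp (Algebra.adjoin k (Set.range x)).val.toRingHom).codRestrict R fun z =>
      algebraMap_mem_adjoin_range_of_mem_adjoin_range P z.2
  have hf : Function.Injective f := fun y z h => Subtype.ext (hg (congrArg Subtype.val h))
  have hA := hx.isAlgebraic
  have halg : ∀ a : A, IsAlgebraic R (Ideal.Quotient.mk P (a ⊗ₜ[k] (1 : B))) := fun a =>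
    (hA.isAlgebraic (Ideal.Quotient.mk _ a)).ringHom_of_comp_eq f g hf rfl
  have hB : ∀ b : B, IsAlgebraic R (Ideal.Quotient.mk P ((1 : A) ⊗ₜ[k] b)) := fun b =>
    isAlgebraic_algebraMap (⟨_, Subalgebra.algebraMap_mem R (Ideal.Quotient.mk _ b)⟩ : R)
  refine ⟨fun z => ?_⟩
  obtain ⟨z, rfl⟩ := Ideal.Quotient.mk_surjective z
  induction z using TensorProduct.induction_on with
  | zero => rw [map_zero]; exact isAlgebraic_zero
  | tmul a b =>
    have : a ⊗ₜ[k] b = (a ⊗ₜ 1) * (1 ⊗ₜ b) := by simp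
    rw [this, map_mul]
    exact (halg a).mul (hB b)
  | add y z hy hz => rw [map_add]; exact hy.add hz

theorem residueTrdeg_le_of_isTranscendenceBasis (hx : IsTranscendenceBasis k x) :
    P.residueTrdeg B ≤ s := by
  have := isAlgebraic_quotient_of_isTranscendenceBasis P hx
  refine (Cardinal.toENat.monotone' (Algebra.IsAlgebraic.trdeg_le_cardinalMk (B ⧸ P.under B)
    (Set.range fun i => algebraMap (A ⧸ P.under A) (A ⊗[k] B ⧸ P) (x i)))).trans ?_
  change Set.encard _ ≤ _
  rw [← Set.image_univ]
  refine (Set.encard_image_le _ _).trans ?_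
  simp

theorem le_residueTrdeg_add_height (hx : AlgebraicIndependent k x)
    (Q : Ideal ((A ⧸ P.under A) ⊗[k] (B ⧸ P.under B))) [Q.IsPrime]
    (hQ : Q.comap (Algebra.TensorProduct.map (Ideal.Quotient.mkₐ k (P.under A))
      (Ideal.Quotient.mkₐ k (P.under B))).toRingHom = P) :
    (s : ℕ∞) ≤ P.residueTrdeg B + Q.height := by
  choose a ha using fun i => Ideal.Quotient.mk_surjective (x i)
  have hmem : ∀ z, Algebra.TensorProduct.map (Ideal.Quotient.mkₐ k (P.under A))
      (Ideal.Quotient.mkₐ k (P.under B)) z ∈ Q ↔ z ∈ P := fun z => by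
    conv_rhs => rw [← hQ]
    rfl
  have hbot : Q.comap (includeLeft : (A ⧸ P.under A) →ₐ[k] _).toRingHom = ⊥ := by
    refine le_bot_iff.mp fun z hz => ?_
    obtain ⟨z, rfl⟩ := Ideal.Quotient.mk_surjective z
    rw [Submodule.mem_bot, Ideal.Quotient.eq_zero_iff_mem]
    have : z ⊗ₜ[k] (1 : B) ∈ P := by
      rw [← hmem, Algebra.TensorProduct.map_tmul, map_one]
      exact hz
    exact this
  have hker : RingHom.ker
      (aeval (fun i => algebraMap (A ⧸ P.under A) (A ⊗[k] B ⧸ P) (x i)) :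
        MvPolynomial (Fin s) (B ⧸ P.under B) →ₐ[_] A ⊗[k] B ⧸ P).toRingHom ≤
      Q.comap (mvPolynomialToTensor k (B ⧸ P.under B) x) := by
    intro F hF
    obtain ⟨G, rfl⟩ := MvPolynomial.map_surjective (Ideal.Quotient.mk (P.under B))
      Ideal.Quotient.mk_surjective F
    have h1 : mvPolynomialToTensor k (B ⧸ P.under B) x
        (MvPolynomial.map (Ideal.Quotient.mk (P.under B)) G) =
        Algebra.TensorProduct.map (Ideal.Quotient.mkₐ k (P.under A))
          (Ideal.Quotient.mkₐ k (P.under B)) (mvPolynomialToTensor k B a G) := by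
      change _ = (Algebra.TensorProduct.map (Ideal.Quotient.mkₐ k (P.under A))
          (Ideal.Quotient.mkₐ k (P.under B))).toRingHom (mvPolynomialToTensor k B a G)
      rw [← RingHom.comp_apply, ← RingHom.comp_apply]
      congr 1
      ext <;> simp [mvPolynomialToTensor, ha]
    have h2 : (aeval (fun i => algebraMap (A ⧸ P.under A) (A ⊗[k] B ⧸ P) (x i)) :
        MvPolynomial (Fin s) (B ⧸ P.under B) →ₐ[_] A ⊗[k] B ⧸ P).toRingHom
        (MvPolynomial.map (Ideal.Quotient.mk (P.under B)) G) =
        Ideal.Quotient.mk P (mvPolynomialToTensor k B a G) := by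
      rw [← RingHom.comp_apply, ← RingHom.comp_apply]
      congr 1
      ext
      · simp [mvPolynomialToTensor]
        rfl
      · simp [mvPolynomialToTensor, ← ha]
    rw [RingHom.mem_ker, h2, Ideal.Quotient.eq_zero_iff_mem] at hF
    rw [Ideal.mem_comap, h1, hmem]
    exact hF
  have hdom : IsDomain (A ⧸ P.under A) := inferInstance
  have h := le_height_ker_aeval_add_toENat_trdeg (E := B ⧸ P.under B)
    fun i => algebraMap (A ⧸ P.under A) (A ⊗[k] B ⧸ P) (x i)
  rw [add_comm]
  exact h.trans (add_le_add_left ((Ideal.height_mono hker).trans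
    (height_comap_mvPolynomialToTensor_le x hx Q hbot)) _)

end ResidueTranscendenceDegreeTensorProduct

theorem Ideal.height_map_mk_of_comap_eq {R S : Type*} [CommRing R] [CommRing S] {f : R →+* S}
    (hf : Function.Surjective f) {I P : Ideal R} (hI : RingHom.ker f = I) {Q : Ideal S}
    (hQ : Q.comap f = P) : (P.map (Ideal.Quotient.mk I)).height = Q.height := by
  subst hI hQ
  rw [← RingEquiv.height_comap (RingHom.quotientKerEquivOfSurjective hf) Q]
  congr 1
  apply Ideal.comap_injective_of_surjective _ (Ideal.Quotient.mk_surjective (I := RingHom.ker f))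
  rw [Ideal.comap_map_of_surjective _ Ideal.Quotient.mk_surjective, ← RingHom.ker_eq_comap_bot,
    Ideal.mk_ker, sup_eq_left.mpr (Ideal.comap_mono bot_le)]
  rfl

section HeightTensorProduct

attribute [local instance] Algebra.TensorProduct.rightAlgebra

variable {k A B : Type*} [Field k] [CommRing A] [CommRing B] [Algebra k A] [Algebra k B]

theorem ker_map_mkₐ_mkₐ (p : Ideal A) (q : Ideal B) :
    RingHom.ker (Algebra.TensorProduct.map (Ideal.Quotient.mkₐ k p)
      (Ideal.Quotient.mkₐ k q)).toRingHom =
    p.map (Algebra.TensorProduct.includeLeft : A →ₐ[k] A ⊗[k] B).toRingHom ⊔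
      q.map (Algebra.TensorProduct.includeRight : B →ₐ[k] A ⊗[k] B).toRingHom := by
  have h := Algebra.TensorProduct.map_ker (Ideal.Quotient.mkₐ k p)
    (Ideal.Quotient.mkₐ k q) Ideal.Quotient.mk_surjective Ideal.Quotient.mk_surjective
  have hp : RingHom.ker (Ideal.Quotient.mkₐ k p) = p := Ideal.Quotient.mkₐ_ker k p
  have hq : RingHom.ker (Ideal.Quotient.mkₐ k q) = q := Ideal.Quotient.mkₐ_ker k q
  rw [hp, hq] at h
  exact h

variable [IsDomain A] {n : ℕ}

theorem height_eq_height_map_C_add_height_add_height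
    (h : ∀ J : Ideal A, J.IsPrime → ∃ s : ℕ, J.height + s = n ∧
      ∃ x : Fin s → A ⧸ J, IsTranscendenceBasis k x)
    {y : Fin n → A} (hy : AlgebraicIndependent k y)
    (P : Ideal (A ⊗[k] B)) [P.IsPrime]
    (Q : Ideal ((A ⧸ P.under A) ⊗[k] (B ⧸ P.under B))) [Q.IsPrime]
    (hQ : Q.comap (Algebra.TensorProduct.map (Ideal.Quotient.mkₐ k (P.under A))
      (Ideal.Quotient.mkₐ k (P.under B))).toRingHom = P) :
    P.height = ((P.under B).map (MvPolynomial.C : B →+* MvPolynomial (Fin n) B)).height +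
      (P.under A).height + Q.height := by
  have hres : ∀ J : Ideal (A ⊗[k] B), J.IsPrime → J.residueTrdeg B ≤ n := by
    intro J hJ
    obtain ⟨s, hs, x, hx⟩ := h (J.under A) inferInstance
    exact (residueTrdeg_le_of_isTranscendenceBasis J hx).trans (le_add_self.trans hs.le)
  obtain ⟨s, hps, x, hx⟩ := h (P.under A) inferInstance
  apply le_antisymm
  · have h1 := Ideal.height_add_residueTrdeg_le B hres P
    have h2 := le_residueTrdeg_add_height P hx.1 Q hQ
    have hfin := ne_top_of_le_ne_top (ENat.natCast_ne_top n) (hres P inferInstance)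
    rw [← ENat.add_le_add_iff_left hfin]
    refine h1.trans ?_
    rw [← hps]
    calc _ ≤ ((P.under B).map (MvPolynomial.C : B →+* MvPolynomial (Fin n) B)).height +
          ((P.under A).height + (P.residueTrdeg B + Q.height)) := by gcongr
      _ = _ := by ring
  · have h := height_map_C_add_height_add_height_le hy (P.under A) (P.under B) Q
    rwa [hQ] at h

end HeightTensorProduct

/-- If `A` is an AF-domain and `P` is a prime of `A ⊗[k] B` with `p = P ∩ A`
and `q = P ∩ B`, then `ht P = ht (q[t.d.(A)]) + ht p + ht (P/(p⊗B + A⊗q))`. -/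
theorem stmt_6 (k A B : Type) [Field k] [CommRing A] [IsDomain A] [CommRing B]
    [Algebra k A] [Algebra k B]
    (ta : ℕ) (hta : eTrdeg k A = ta) (hBfin : eTrdeg k B ≠ ⊤)
    (hAF : IsAFDomain k A)
    (P : Ideal (A ⊗[k] B)) (hP : P.IsPrime)
    (p : Ideal A)
    (hp : p = P.comap (Algebra.TensorProduct.includeLeft : A →ₐ[k] A ⊗[k] B).toRingHom)
    (q : Ideal B)
    (hq : q = P.comap (Algebra.TensorProduct.includeRight : B →ₐ[k] A ⊗[k] B).toRingHom) :
    idealHt P = idealHt (polyExt ta q) + idealHt p +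
      idealHt (P.map (Ideal.Quotient.mk
        (p.map (Algebra.TensorProduct.includeLeft : A →ₐ[k] A ⊗[k] B).toRingHom ⊔
         q.map (Algebra.TensorProduct.includeRight : B →ₐ[k] A ⊗[k] B).toRingHom))) := by
  obtain rfl : p = P.under A := hp
  obtain ⟨y, hy⟩ := exists_fin_isTranscendenceBasis hta
  let _ : Algebra B (A ⊗[k] B) := Algebra.TensorProduct.rightAlgebra
  obtain rfl : q = P.under B := hq
  have hker := ker_map_mkₐ_mkₐ (k := k) (P.under A) (P.under B)
  have hsurj : Function.Surjective (Algebra.TensorProduct.map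
      (Ideal.Quotient.mkₐ k (P.under A)) (Ideal.Quotient.mkₐ k (P.under B))).toRingHom :=
    TensorProduct.map_surjective Ideal.Quotient.mk_surjective Ideal.Quotient.mk_surjective
  obtain ⟨Q, hQ, hQP⟩ := Ideal.exists_isPrime_comap_eq_of_ker_le hsurj
    (hker.trans_le (sup_le (Ideal.map_le_iff_le_comap.mpr le_rfl)
      (Ideal.map_le_iff_le_comap.mpr le_rfl)))
  rw [idealHt_eq_height, idealHt_eq_height, idealHt_eq_height, idealHt_eq_height, polyExt,
    Ideal.height_map_mk_of_comap_eq hsurj hker hQP]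
  refine height_eq_height_map_C_add_height_add_height (fun J hJ => ?_) hy.1 P Q hQP
  have h := hAF J hJ
  rw [hta, idealHt_eq_height] at h
  obtain ⟨s, hs⟩ := ENat.ne_top_iff_exists.mp
    (ne_top_of_le_ne_top (ENat.natCast_ne_top ta) (le_add_self.trans h.le))
  rw [← hs] at h
  exact ⟨s, h, exists_fin_isTranscendenceBasis hs.symm⟩
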